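/- Let A, A_s ∈ ℝ^{N×N}, b ∈ ℝ^N, λ ∈ ℝ, and suppose x*, x_s* ∈ ℝ^N satisfy Aᵀ(Ax* − b) + λ²x* = 0 and A_sᵀ(A_s x_s* − b) + λ²x_s* = 0. Let Φ(x) = ½‖Ax−b‖₂² + (λ²/2)‖x‖₂² and Φ_s(x) = ½‖A_s x−b‖₂² + (λ²/2)‖x‖₂². Then |Φ_s(x_s*) − Φ(x*)| ≤ ½‖b‖₂ (‖A‖₂‖x* − x_s*‖₂ + ‖A − A_s‖₂‖x_s*‖₂). -/

import Mathlib

open Matrix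
noncomputable section

/-- Multiplication of a matrix with a vector of `EuclideanSpace ℝ (Fin N)`. -/
def mulVecE {N : ℕ} (A : Matrix (Fin N) (Fin N) ℝ) (x : EuclideanSpace ℝ (Fin N)) :
    EuclideanSpace ℝ (Fin N) :=
  (WithLp.equiv 2 (Fin N → ℝ)).symm (A.mulVec ((WithLp.equiv 2 (Fin N → ℝ)) x))

/-- The operator 2-norm of a matrix, induced by the Euclidean norms. -/
def opNorm {N : ℕ} (A : Matrix (Fin N) (Fin N) ℝ) : ℝ :=
  ‖Matrix.toEuclideanCLM (𝕜 := ℝ) A‖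

theorem mulVecE_eq_toEuclideanCLM {N : ℕ} (A : Matrix (Fin N) (Fin N) ℝ)
    (x : EuclideanSpace ℝ (Fin N)) :
    mulVecE A x = Matrix.toEuclideanCLM (𝕜 := ℝ) A x := rfl

theorem norm_mulVecE_le {N : ℕ} (A : Matrix (Fin N) (Fin N) ℝ)
    (x : EuclideanSpace ℝ (Fin N)) : ‖mulVecE A x‖ ≤ opNorm A * ‖x‖ :=
  (Matrix.toEuclideanCLM (𝕜 := ℝ) A).le_opNorm x

theorem inner_mulVecE_transpose {N : ℕ} (A : Matrix (Fin N) (Fin N) ℝ)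
    (x y : EuclideanSpace ℝ (Fin N)) :
    inner ℝ (mulVecE Aᵀ y) x = inner ℝ y (mulVecE A x) := by
  rw [mulVecE_eq_toEuclideanCLM, mulVecE_eq_toEuclideanCLM,
    ← Matrix.conjTranspose_eq_transpose_of_trivial, ← Matrix.star_eq_conjTranspose, map_star,
    ContinuousLinearMap.star_eq_adjoint, ContinuousLinearMap.adjoint_inner_left]

/-- The value of the regularized least squares objective at a stationary point. -/
theorem objective_eq_of_stationary {N : ℕ} (A : Matrix (Fin N) (Fin N) ℝ)
    (b x : EuclideanSpace ℝ (Fin N)) (lam : ℝ)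
    (h : mulVecE Aᵀ (mulVecE A x - b) + lam ^ 2 • x = 0) :
    1 / 2 * ‖mulVecE A x - b‖ ^ 2 + lam ^ 2 / 2 * ‖x‖ ^ 2 =
      1 / 2 * inner ℝ b (b - mulVecE A x) := by
  have h0 : inner ℝ (mulVecE A x - b) (mulVecE A x) + lam ^ 2 * ‖x‖ ^ 2 = 0 := by
    rw [← inner_mulVecE_transpose, ← real_inner_self_eq_norm_sq x, ← real_inner_smul_left,
      ← inner_add_left, h, inner_zero_left]
  rw [← real_inner_self_eq_norm_sq (mulVecE A x - b)]
  simp only [inner_sub_left, inner_sub_right] at h0 ⊢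
  linarith [real_inner_comm b (mulVecE A x)]

/-- If `x*` and `x_s*` satisfy the optimality conditions for `A` and `A_s`, then
`|Φ_s(x_s*) − Φ(x*)| ≤ ½‖b‖(‖A‖₂‖x* − x_s*‖ + ‖A − A_s‖₂‖x_s*‖)`. -/
theorem optimal_value_difference_bound {N : ℕ}
    (A As : Matrix (Fin N) (Fin N) ℝ) (b xstar xsstar : EuclideanSpace ℝ (Fin N))
    (lam : ℝ)
    (h1 : mulVecE Aᵀ (mulVecE A xstar - b) + lam ^ 2 • xstar = 0)
    (h2 : mulVecE Asᵀ (mulVecE As xsstar - b) + lam ^ 2 • xsstar = 0)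
    (Φ Φs : EuclideanSpace ℝ (Fin N) → ℝ)
    (hΦ : ∀ z, Φ z = 1 / 2 * ‖mulVecE A z - b‖ ^ 2 + lam ^ 2 / 2 * ‖z‖ ^ 2)
    (hΦs : ∀ z, Φs z = 1 / 2 * ‖mulVecE As z - b‖ ^ 2 + lam ^ 2 / 2 * ‖z‖ ^ 2) :
    |Φs xsstar - Φ xstar| ≤
      1 / 2 * ‖b‖ * (opNorm A * ‖xstar - xsstar‖ + opNorm (A - As) * ‖xsstar‖) := by
  have key : Φs xsstar - Φ xstar =
      1 / 2 * inner ℝ b (mulVecE A (xstar - xsstar) + mulVecE (A - As) xsstar) := by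
    rw [hΦ, hΦs, objective_eq_of_stationary A b xstar lam h1,
      objective_eq_of_stationary As b xsstar lam h2, ← mul_sub, ← inner_sub_right]
    congr 2
    simp only [mulVecE_eq_toEuclideanCLM, map_sub, _root_.sub_apply]
    abel
  rw [key, abs_mul, abs_of_nonneg (by norm_num : (0 : ℝ) ≤ 1 / 2), mul_assoc]
  gcongr
  calc |inner ℝ b (mulVecE A (xstar - xsstar) + mulVecE (A - As) xsstar)|
      ≤ ‖b‖ * ‖mulVecE A (xstar - xsstar) + mulVecE (A - As) xsstar‖ :=
        abs_real_inner_le_norm _ _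
    _ ≤ ‖b‖ * (opNorm A * ‖xstar - xsstar‖ + opNorm (A - As) * ‖xsstar‖) := by
        gcongr
        exact norm_add_le_of_le (norm_mulVecE_le _ _) (norm_mulVecE_le _ _)
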